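/- arXiv:1001.3705 — 5 statements merged into one kernel-verified Lean document; each statement's English description precedes it below -/
import Mathlib

section
/- Let Σ be a symmetric positive definite 3×3 real covariance matrix with diagonal entries Σ_x, Σ_y, Σ_z and off-diagonal entries Σ_xy, Σ_xz, Σ_yz. Assume Σ_xy ≠ 0 and Σ_xy² Σ_y⁻¹ Σ_x⁻¹ > Σ_xz² Σ_z⁻¹ Σ_x⁻¹. Then the symmetric 3×3 matrix Σ̄ defined by Σ̄_x = Σ_x, Σ̄_y = Σ_y, Σ̄_z = Σ_z, Σ̄_xy = Σ_xy, Σ̄_xz = Σ_xz, and Σ̄_yz = Σ_xz Σ_y Σ_xy⁻¹ is positive definite and satisfies the identity Σ̄_xz Σ̄_y = Σ̄_xy Σ̄_yz. -/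
open scoped Matrix

/-- A Gaussian Markov chain covariance, with regression coefficient `t` of the third variable on
the second, is positive definite once both conditional variances given the second variable are
positive. -/
theorem Matrix.posDef_of_markov {a b c p t : ℝ} (hb : 0 < b) (hab : p ^ 2 < a * b)
    (hbc : t ^ 2 * b < c) :
    (!![a, p, t * p; p, b, t * b; t * p, t * b, c] : Matrix (Fin 3) (Fin 3) ℝ).PosDef := by
  refine Matrix.PosDef.of_dotProduct_mulVec_pos ?_ fun v hv => ?_
  · ext i j
    fin_cases i <;> fin_cases j <;> simp
  have hform : star v ⬝ᵥ (!![a, p, t * p; p, b, t * b; t * p, t * b, c] *ᵥ v) =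
      b * (v 1 + t * v 2 + p / b * v 0) ^ 2 + (a * b - p ^ 2) / b * v 0 ^ 2 +
        (c - t ^ 2 * b) * v 2 ^ 2 := by
    simp [dotProduct, Matrix.mulVec, Fin.sum_univ_three]
    field_simp
    ring
  rw [hform]
  have hcoeff₀ : 0 < (a * b - p ^ 2) / b := div_pos (sub_pos.2 hab) hb
  have hcoeff₂ : 0 < c - t ^ 2 * b := sub_pos.2 hbc
  by_cases h0 : v 0 = 0
  · by_cases h2 : v 2 = 0
    · have h1 : v 1 ≠ 0 := fun h1 => hv <| by
        ext i
        fin_cases i <;> simp [h0, h1, h2]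
      simp only [h0, h2, mul_zero, add_zero]
      positivity
    · positivity
  · positivity

/-- Degradation lemma, first case. If the symmetric 3×3 covariance
matrix `Σ` of `(X,Y,Z)` is positive definite, `Σ_xy ≠ 0`, and
`Σ_xy² Σ_y⁻¹ Σ_x⁻¹ > Σ_xz² Σ_z⁻¹ Σ_x⁻¹`, then the symmetric matrix `Σ̄`
obtained from `Σ` by replacing the `(y,z)` entry with `Σ_xz Σ_y Σ_xy⁻¹` is
positive definite and satisfies `Σ̄_xz Σ̄_y = Σ̄_xy Σ̄_yz` (the Markov chain
`X̄ → Ȳ → Z̄` condition). -/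
theorem stmt_1 (Sx Sy Sz Sxy Sxz Syz : ℝ)
    (hpd : (!![Sx, Sxy, Sxz; Sxy, Sy, Syz; Sxz, Syz, Sz] :
      Matrix (Fin 3) (Fin 3) ℝ).PosDef)
    (hxy : Sxy ≠ 0)
    (hcorr : Sxz ^ 2 * Sz⁻¹ * Sx⁻¹ < Sxy ^ 2 * Sy⁻¹ * Sx⁻¹) :
    (!![Sx, Sxy, Sxz;
        Sxy, Sy, Sxz * Sy * Sxy⁻¹;
        Sxz, Sxz * Sy * Sxy⁻¹, Sz] : Matrix (Fin 3) (Fin 3) ℝ).PosDef ∧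
    Sxz * Sy = Sxy * (Sxz * Sy * Sxy⁻¹) := by
  have hx : 0 < Sx := by simpa using hpd.diag_pos (i := 0)
  have hy : 0 < Sy := by simpa using hpd.diag_pos (i := 1)
  have hz : 0 < Sz := by simpa using hpd.diag_pos (i := 2)
  have hminor : Sxy ^ 2 < Sx * Sy := by
    have h := (hpd.submatrix (e := ![0, 1]) (by decide)).det_pos
    rw [Matrix.det_fin_two] at h
    simpa [pow_two] using h
  have hcond : (Sxz * Sxy⁻¹) ^ 2 * Sy < Sz := by
    have h := lt_of_mul_lt_mul_right hcorr (inv_pos.2 hx).le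
    rw [← div_eq_mul_inv, ← div_eq_mul_inv, div_lt_div_iff₀ hz hy] at h
    rw [← div_eq_mul_inv, div_pow, div_mul_eq_mul_div, div_lt_iff₀ (by positivity)]
    linarith
  refine ⟨?_, by field_simp⟩
  have h := Matrix.posDef_of_markov hy hminor hcond
  rwa [inv_mul_cancel_right₀ hxy, mul_right_comm] at h
end

section
/- Let Σ be a symmetric positive definite 3×3 real covariance matrix with diagonal entries Σ_x, Σ_y, Σ_z and off-diagonal entries Σ_xy, Σ_xz, Σ_yz. Assume Σ_xz ≠ 0 and Σ_xy² Σ_y⁻¹ Σ_x⁻¹ ≤ Σ_xz² Σ_z⁻¹ Σ_x⁻¹. Then the symmetric 3×3 matrix Σ̄ defined by Σ̄_x = Σ_x, Σ̄_y = Σ_y, Σ̄_z = Σ_z, Σ̄_xy = Σ_xy, Σ̄_xz = Σ_xz, and Σ̄_yz = Σ_xy Σ_z Σ_xz⁻¹ is positive semidefinite and satisfies the identity Σ̄_xy Σ̄_z = Σ̄_xz Σ̄_zy, where Σ̄_zy = Σ̄_yz. -/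
/-- Degradation lemma, second case. If the symmetric 3×3 covariance
matrix `Σ` of `(X,Y,Z)` is positive definite, `Σ_xz ≠ 0`, and
`Σ_xy² Σ_y⁻¹ Σ_x⁻¹ ≤ Σ_xz² Σ_z⁻¹ Σ_x⁻¹`, then the symmetric matrix `Σ̄`
obtained from `Σ` by replacing the `(y,z)` entry with `Σ_xy Σ_z Σ_xz⁻¹` is
positive semidefinite and satisfies `Σ̄_xy Σ̄_z = Σ̄_xz Σ̄_zy` (the Markov chain
`X̄ → Z̄ → Ȳ` condition). -/
theorem stmt_2 (Sx Sy Sz Sxy Sxz Syz : ℝ)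
    (hpd : (!![Sx, Sxy, Sxz; Sxy, Sy, Syz; Sxz, Syz, Sz] :
      Matrix (Fin 3) (Fin 3) ℝ).PosDef)
    (hxz : Sxz ≠ 0)
    (hcorr : Sxy ^ 2 * Sy⁻¹ * Sx⁻¹ ≤ Sxz ^ 2 * Sz⁻¹ * Sx⁻¹) :
    (!![Sx, Sxy, Sxz;
        Sxy, Sy, Sxy * Sz * Sxz⁻¹;
        Sxz, Sxy * Sz * Sxz⁻¹, Sz] : Matrix (Fin 3) (Fin 3) ℝ).PosSemidef ∧
    Sxy * Sz = Sxz * (Sxy * Sz * Sxz⁻¹) := by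
  have hx : 0 < Sx := hpd.diag_pos (i := 0)
  have hy : 0 < Sy := hpd.diag_pos (i := 1)
  have hz : 0 < Sz := hpd.diag_pos (i := 2)
  have hminor : 0 ≤ Sx - Sxz ^ 2 / Sz := by
    have h := hpd.posSemidef.dotProduct_mulVec_nonneg ![1, 0, -Sxz / Sz]
    simp only [Matrix.mulVec, dotProduct, Fin.sum_univ_three, Pi.star_apply, star_trivial,
      Matrix.of_apply, Matrix.cons_val] at h
    refine h.trans_eq ?_
    field_simp
    ring
  obtain ⟨k, rfl⟩ : ∃ k, Sxy = k * Sxz := ⟨Sxy / Sxz, by field_simp⟩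
  have hyz : k * Sxz * Sz * Sxz⁻¹ = k * Sz := by field_simp
  have hk : 0 ≤ Sy - k ^ 2 * Sz := by
    have h := le_of_mul_le_mul_right hcorr (inv_pos.mpr hx)
    rw [← div_eq_mul_inv, ← div_eq_mul_inv, div_le_div_iff₀ hy hz] at h
    have hxz2 : 0 < Sxz ^ 2 := by positivity
    nlinarith
  rw [hyz]
  refine ⟨.of_dotProduct_mulVec_nonneg ?_ fun v => ?_, by ring⟩
  · ext i j
    fin_cases i <;> fin_cases j <;> rfl
  · have hsq : 0 ≤ Sz * (v 2 + k * v 1 + Sxz / Sz * v 0) ^ 2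
        + (Sx - Sxz ^ 2 / Sz) * v 0 ^ 2 + (Sy - k ^ 2 * Sz) * v 1 ^ 2 := by positivity
    simp only [Matrix.mulVec, dotProduct, Fin.sum_univ_three, Pi.star_apply, star_trivial,
      Matrix.of_apply, Matrix.cons_val]
    refine hsq.trans_eq ?_
    field_simp
    ring
end

section
/- Let Q, S, C be finite nonempty sets, and let F be a finite nonempty family of functions from Q to S that is universal: for all distinct u, û ∈ Q, the number of f ∈ F with f(u) = f(û) is at most |F|/|S|. Let p : Q → ℝ be nonnegative and let φ : Q → C be any function. Then the average over f ∈ F (with uniform weights 1/|F|) of Σ_{s∈S} Σ_{c∈C} (Σ_{u : f(u)=s, φ(u)=c} p(u))² is at most (1/|S|)·Σ_{c∈C} (Σ_{u : φ(u)=c} p(u))² + Σ_{u∈Q} p(u)². -/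
open Finset

/-- The sum of the squared fiber masses of `g` is the sum of `p u * p v` over the pairs that
collide under `g`. -/
theorem sum_sq_sum_fiber {Q T : Type*} [Fintype Q] [Fintype T] [DecidableEq T]
    (g : Q → T) (p : Q → ℝ) :
    ∑ t : T, (∑ u ∈ univ.filter fun u => g u = t, p u) ^ 2
      = ∑ u : Q, ∑ v : Q, if g u = g v then p u * p v else 0 := by
  have expand (t : T) : (∑ u ∈ univ.filter fun u => g u = t, p u) ^ 2
      = ∑ u : Q, if g u = t then ∑ v : Q, (if g v = t then p u * p v else 0) else 0 := by
    rw [sq, sum_mul_sum, sum_filter]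
    simp only [sum_filter]
  simp only [expand]
  rw [sum_comm]
  simp [eq_comm]

/-- The sum of the squared masses of the joint fibers of `f` and `φ`, as a sum over the pairs
that collide under both. -/
theorem sum_sq_sum_joint_fiber {Q S C : Type*} [Fintype Q] [Fintype S] [Fintype C]
    [DecidableEq S] [DecidableEq C] (f : Q → S) (φ : Q → C) (p : Q → ℝ) :
    ∑ s : S, ∑ c : C, (∑ u ∈ univ.filter fun u => f u = s ∧ φ u = c, p u) ^ 2
      = ∑ u : Q, ∑ v : Q, if f u = f v ∧ φ u = φ v then p u * p v else 0 := by
  have h := sum_sq_sum_fiber (fun u => (f u, φ u)) p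
  rw [Fintype.sum_prod_type] at h
  simpa only [Prod.mk.injEq] using h

/-- Second-moment bound for universal hash families. If `F` is a
nonempty family of functions `Q → S` such that for all distinct `u, û` the
number of `f ∈ F` with `f u = f û` is at most `|F|/|S|`, `p : Q → ℝ` is
nonnegative and `φ : Q → C` is arbitrary, then the average over `f ∈ F` of
`Σ_s Σ_c (Σ_{u : f u = s, φ u = c} p u)²` is at most
`(1/|S|)·Σ_c (Σ_{u : φ u = c} p u)² + Σ_u p(u)²`. -/
theorem stmt_8 {Q S C : Type*} [Fintype Q] [Fintype S] [Fintype C]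
    [DecidableEq Q] [DecidableEq S] [DecidableEq C]
    [Nonempty Q] [Nonempty S] [Nonempty C]
    (F : Finset (Q → S)) (hF : F.Nonempty)
    (huniv : ∀ u uhat : Q, u ≠ uhat →
      ((F.filter fun f => f u = f uhat).card : ℝ) ≤ F.card / Fintype.card S)
    (p : Q → ℝ) (hp : ∀ u, 0 ≤ p u) (φ : Q → C) :
    (F.card : ℝ)⁻¹ *
        ∑ f ∈ F, ∑ s : S, ∑ c : C,
          (∑ u ∈ univ.filter fun u => f u = s ∧ φ u = c, p u) ^ 2
      ≤ (Fintype.card S : ℝ)⁻¹ *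
          ∑ c : C, (∑ u ∈ univ.filter fun u => φ u = c, p u) ^ 2
        + ∑ u : Q, p u ^ 2 := by
  have hcard : (0 : ℝ) < F.card := by exact_mod_cast hF.card_pos
  have collisions (u v : Q) :
      ∑ f ∈ F, (if f u = f v ∧ φ u = φ v then p u * p v else 0)
        = (F.filter fun f => f u = f v).card * (if φ u = φ v then p u * p v else 0) := by
    by_cases h : φ u = φ v <;> simp [h, ← sum_filter]
  have diagonal : ∑ u : Q, p u ^ 2 = ∑ u : Q, ∑ v : Q, if u = v then p u ^ 2 else 0 := by
    simp
  simp only [sum_sq_sum_joint_fiber]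
  rw [sum_sq_sum_fiber, diagonal, sum_comm, mul_sum, mul_sum, ← sum_add_distrib]
  refine sum_le_sum fun u _ => ?_
  rw [sum_comm, mul_sum, mul_sum, ← sum_add_distrib]
  refine sum_le_sum fun v _ => ?_
  rw [collisions, ← mul_assoc]
  have hweight : 0 ≤ if φ u = φ v then p u * p v else 0 := by
    split_ifs
    exacts [mul_nonneg (hp u) (hp v), le_rfl]
  by_cases huv : u = v
  · subst huv
    have hS : (0 : ℝ) ≤ (Fintype.card S : ℝ)⁻¹ * (p u * p u) :=
      mul_nonneg (by positivity) (mul_self_nonneg _)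
    simpa [hcard.ne', sq] using hS
  · rw [if_neg huv, add_zero]
    refine mul_le_mul_of_nonneg_right ?_ hweight
    rw [inv_mul_le_iff₀ hcard, ← div_eq_mul_inv]
    exact huniv u v huv
end

section
/- Let ρ be a probability measure on ℝ^m × ℝ^m (the joint law of a pair (X,Z)), let ρ_Z be its second marginal, and let κ be a regular conditional distribution of the first coordinate given the second (so κ(z) is a probability measure on ℝ^m for ρ_Z-almost every z, disintegrating ρ). Let Q, C, S be finite nonempty sets, let g : ℝ^m → Q be measurable, let φ : Q → C be any function, and let β ∈ ℝ, n ∈ ℕ. Define the measurable set B := {(x,z) ∈ ℝ^m × ℝ^m : κ(z)(g⁻¹({g(x)})) ≤ e^{−βn}}. Then there exists a function f : Q → S such that ∫ [ Σ_{s∈S} Σ_{c∈C} | κ(z)({x : f(g(x)) = s and φ(g(x)) = c}) − (1/|S|)·κ(z)({x : φ(g(x)) = c}) | ] dρ_Z(z) ≤ √(|S|·|C|·e^{−βn}) + 2·ρ(Bᶜ). -/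
open MeasureTheory ProbabilityTheory

namespace PrivacyAmplification

/-- The indicator of `r = s`, centred at its mean under the uniform law of `r`. -/
noncomputable def centered {S : Type*} [Fintype S] [DecidableEq S] (s r : S) : ℝ :=
  (if r = s then 1 else 0) - (Fintype.card S : ℝ)⁻¹

/-- The signed deviation, at `(s, c)`, between the law of `(f, φ)` under the weights `p` and the
product of the uniform law with the law of `φ`. -/
noncomputable def deviation {Q C S : Type*} [Fintype Q] [Fintype S] [DecidableEq C]
    [DecidableEq S] (φ : Q → C) (f : Q → S) (p : Q → ℝ) (s : S) (c : C) : ℝ :=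
  ∑ q, (if φ q = c then p q else 0) * centered s (f q)

lemma sum_fun_mul_eq_zero {Q S : Type*} [Fintype Q] [Fintype S] [DecidableEq Q]
    {u : S → ℝ} (hu : ∑ r, u r = 0) (v : S → ℝ) {q q' : Q} (h : q' ≠ q) :
    ∑ f : Q → S, u (f q) * v (f q') = 0 := by
  rw [← (Equiv.funSplitAt q S).symm.sum_comp, Fintype.sum_prod_type, Finset.sum_comm]
  simp [Equiv.funSplitAt, Equiv.piSplitAt, h, ← Finset.sum_mul, hu]

section Finite

variable {Q C S : Type*} [Fintype Q] [Fintype C] [Fintype S] [DecidableEq C] [DecidableEq S]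

lemma sum_centered_right [Nonempty S] (s : S) : ∑ r, centered s r = 0 := by
  simp [centered, Finset.sum_sub_distrib]

lemma sum_centered_sq_le_one [Nonempty S] (r : S) : ∑ s, centered s r ^ 2 ≤ 1 := by
  have hM : (1 : ℝ) ≤ Fintype.card S := by exact_mod_cast Fintype.card_pos
  have hM0 : (Fintype.card S : ℝ) ≠ 0 := by positivity
  have h : ∀ s : S, centered s r ^ 2 =
      (if r = s then 1 - 2 * (Fintype.card S : ℝ)⁻¹ else 0) + (Fintype.card S : ℝ)⁻¹ ^ 2 := by
    intro s
    unfold centered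
    split_ifs <;> ring
  simp only [h, Finset.sum_add_distrib, Finset.sum_ite_eq, Finset.mem_univ, if_true,
    Finset.sum_const, Finset.card_univ, nsmul_eq_mul]
  have : (Fintype.card S : ℝ) * (Fintype.card S : ℝ)⁻¹ ^ 2 = (Fintype.card S : ℝ)⁻¹ := by
    field_simp
  rw [this]
  have : 0 ≤ (Fintype.card S : ℝ)⁻¹ := by positivity
  linarith

lemma sum_abs_centered_le_two [Nonempty S] (r : S) : ∑ s, |centered s r| ≤ 2 := by
  have h : ∀ s : S, |centered s r| ≤ (if r = s then 1 else 0) + (Fintype.card S : ℝ)⁻¹ := by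
    intro s
    have : 0 ≤ (Fintype.card S : ℝ)⁻¹ := by positivity
    unfold centered
    split_ifs <;> rw [abs_le] <;> constructor <;> linarith
  refine (Finset.sum_le_sum fun s _ => h s).trans ?_
  simp only [Finset.sum_add_distrib, Finset.sum_ite_eq, Finset.mem_univ, if_true,
    Finset.sum_const, Finset.card_univ, nsmul_eq_mul]
  rw [mul_inv_cancel₀ (by positivity)]
  norm_num

lemma sum_abs_deviation_le_two_mul [Nonempty S] (φ : Q → C) (f : Q → S) {p : Q → ℝ}
    (hp : ∀ q, 0 ≤ p q) : ∑ s, ∑ c, |deviation φ f p s c| ≤ 2 * ∑ q, p q := by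
  calc ∑ s, ∑ c, |deviation φ f p s c|
      ≤ ∑ s, ∑ c, ∑ q, (if φ q = c then p q else 0) * |centered s (f q)| := by
        gcongr with s _ c _
        refine (Finset.abs_sum_le_sum_abs _ _).trans (Finset.sum_le_sum fun q _ => ?_)
        rw [abs_mul, abs_of_nonneg]
        split_ifs
        exacts [hp q, le_rfl]
    _ = ∑ q, p q * ∑ s, |centered s (f q)| := by
        simp only [Finset.mul_sum]
        rw [Finset.sum_comm (γ := Q)]
        refine Finset.sum_congr rfl fun s _ => ?_
        rw [Finset.sum_comm]
        simp
    _ ≤ ∑ q, p q * 2 := by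
        gcongr with q _
        exacts [hp q, sum_abs_centered_le_two _]
    _ = _ := by rw [← Finset.sum_mul, mul_comm]

variable [DecidableEq Q]

lemma sum_deviation_sq_le [Nonempty S] (φ : Q → C) (p : Q → ℝ) :
    ∑ f : Q → S, ∑ s, ∑ c, deviation φ f p s c ^ 2 ≤
      Fintype.card (Q → S) * ∑ q, p q ^ 2 := by
  have key : ∀ (s : S) (c : C), ∑ f : Q → S, deviation φ f p s c ^ 2 =
      ∑ f : Q → S, ∑ q, (if φ q = c then p q ^ 2 else 0) * centered s (f q) ^ 2 := by
    intro s c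
    simp only [deviation, sq (Finset.sum _ _), Finset.sum_mul_sum]
    rw [Finset.sum_comm, Finset.sum_comm (γ := Q → S)]
    refine Finset.sum_congr rfl fun q _ => ?_
    rw [Finset.sum_comm, Finset.sum_eq_single q]
    · refine Finset.sum_congr rfl fun f _ => ?_
      split_ifs <;> ring
    · intro q' _ hq
      have h := sum_fun_mul_eq_zero (sum_centered_right s) (centered s) hq
      calc _ = ((if φ q = c then p q else 0) * (if φ q' = c then p q' else 0)) *
            ∑ f : Q → S, centered s (f q) * centered s (f q') := by
              rw [Finset.mul_sum]
              exact Finset.sum_congr rfl fun f _ => by ring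
        _ = 0 := by rw [h, mul_zero]
    · simp
  calc ∑ f : Q → S, ∑ s, ∑ c, deviation φ f p s c ^ 2
      = ∑ s, ∑ c, ∑ f : Q → S, deviation φ f p s c ^ 2 := by
        rw [Finset.sum_comm]
        exact Finset.sum_congr rfl fun s _ => Finset.sum_comm
    _ = ∑ s, ∑ c, ∑ f : Q → S, ∑ q,
          (if φ q = c then p q ^ 2 else 0) * centered s (f q) ^ 2 := by simp only [key]
    _ = ∑ f : Q → S, ∑ s, ∑ c, ∑ q,
          (if φ q = c then p q ^ 2 else 0) * centered s (f q) ^ 2 := by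
        rw [Finset.sum_comm (γ := Q → S)]
        exact Finset.sum_congr rfl fun s _ => Finset.sum_comm
    _ = ∑ f : Q → S, ∑ q, p q ^ 2 * ∑ s, centered s (f q) ^ 2 := by
        refine Finset.sum_congr rfl fun f _ => ?_
        simp only [Finset.mul_sum]
        rw [Finset.sum_comm (γ := Q)]
        refine Finset.sum_congr rfl fun s _ => ?_
        rw [Finset.sum_comm]
        simp
    _ ≤ ∑ f : Q → S, ∑ q, p q ^ 2 * 1 := by
        gcongr with f _ q _
        exact sum_centered_sq_le_one _
    _ = _ := by simp

lemma sum_abs_deviation_le_sqrt [Nonempty S] (φ : Q → C) {p : Q → ℝ} {t : ℝ}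
    (hp : ∑ q, p q ^ 2 ≤ t) :
    ∑ f : Q → S, ∑ s, ∑ c, |deviation φ f p s c| ≤
      Fintype.card (Q → S) * √(Fintype.card S * Fintype.card C * t) := by
  have hcs := sq_sum_le_card_mul_sum_sq (s := (Finset.univ : Finset ((Q → S) × S × C)))
    (f := fun x => |deviation φ x.1 p x.2.1 x.2.2|)
  simp only [Fintype.sum_prod_type, sq_abs, Finset.card_univ, Fintype.card_prod] at hcs
  have hle := sum_deviation_sq_le (S := S) φ p
  rw [← Real.sqrt_sq (Nat.cast_nonneg (α := ℝ) (Fintype.card (Q → S))),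
    ← Real.sqrt_mul (by positivity)]
  apply Real.le_sqrt_of_sq_le
  refine hcs.trans ?_
  push_cast
  calc _ ≤ (Fintype.card (Q → S) * (Fintype.card S * Fintype.card C) : ℝ) *
        (Fintype.card (Q → S) * t) := by
        gcongr
        exact hle.trans (by gcongr)
    _ = _ := by ring

/-- Averaging over all key maps `f : Q → S`, with the weights above the threshold `t` treated as
an error term. -/
lemma sum_abs_deviation_le [Nonempty S] (φ : Q → C) {p : Q → ℝ} {t : ℝ} (ht : 0 ≤ t)
    (hp : ∀ q, 0 ≤ p q) (hsum : ∑ q, p q ≤ 1) :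
    ∑ f : Q → S, ∑ s, ∑ c, |deviation φ f p s c| ≤
      Fintype.card (Q → S) * (√(Fintype.card S * Fintype.card C * t) +
        2 * ∑ q, if t < p q then p q else 0) := by
  set a : Q → ℝ := fun q => if t < p q then 0 else p q with ha
  set b : Q → ℝ := fun q => if t < p q then p q else 0 with hb
  have ha2 : ∑ q, a q ^ 2 ≤ t := by
    calc ∑ q, a q ^ 2 ≤ ∑ q, t * p q := by
          gcongr with q _
          simp only [ha]
          split_ifs with h
          · have := mul_nonneg ht (hp q)
            simpa using this
          · rw [sq]
            exact mul_le_mul_of_nonneg_right (not_lt.1 h) (hp q)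
      _ = t * ∑ q, p q := by rw [Finset.mul_sum]
      _ ≤ t := mul_le_of_le_one_right ht hsum
  have hb0 : ∀ q, 0 ≤ b q := fun q => by
    simp only [hb]
    split_ifs
    exacts [hp q, le_rfl]
  have hsplit : ∀ (f : Q → S) s c,
      deviation φ f p s c = deviation φ f a s c + deviation φ f b s c := by
    intro f s c
    simp only [deviation, ← Finset.sum_add_distrib, ha, hb]
    refine Finset.sum_congr rfl fun q _ => ?_
    split_ifs <;> ring
  calc ∑ f : Q → S, ∑ s, ∑ c, |deviation φ f p s c|
      ≤ ∑ f : Q → S, ∑ s, ∑ c, (|deviation φ f a s c| + |deviation φ f b s c|) := by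
        gcongr with f _ s _ c _
        rw [hsplit]
        exact abs_add_le _ _
    _ = ∑ f : Q → S, ∑ s, ∑ c, |deviation φ f a s c| +
          ∑ f : Q → S, ∑ s, ∑ c, |deviation φ f b s c| := by
        simp only [Finset.sum_add_distrib]
    _ ≤ Fintype.card (Q → S) * √(Fintype.card S * Fintype.card C * t) +
          ∑ f : Q → S, 2 * ∑ q, b q := by
        gcongr with f _
        · exact sum_abs_deviation_le_sqrt φ ha2
        · exact sum_abs_deviation_le_two_mul φ f hb0
    _ = _ := by
        rw [Finset.sum_const, Finset.card_univ, nsmul_eq_mul, mul_add]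

end Finite

section Measure

variable {Q : Type*} [Fintype Q] [MeasurableSpace Q] [DiscreteMeasurableSpace Q]

lemma measureReal_setOf_comp {α : Type*} [MeasurableSpace α] (μ : Measure α) [IsFiniteMeasure μ]
    {g : α → Q} (hg : Measurable g) (P : Q → Prop) [DecidablePred P] :
    μ.real {x | P (g x)} = ∑ q, if P q then μ.real (g ⁻¹' {q}) else 0 := by
  rw [← Finset.sum_filter, sum_measureReal_preimage_singleton]
  · congr 1
    ext x
    simp
  · exact fun q _ => hg (measurableSet_singleton q)

end Measure

end PrivacyAmplification

open PrivacyAmplification in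
/-- Privacy amplification lemma (Lemma 4). `ρ` is the joint law
of `(X,Z)` on `ℝ^m × ℝ^m`, `κ` is a regular conditional distribution of the
first coordinate given the second (disintegrating `ρ` over its second marginal
`ρ_Z`), `g` is a quantizer into the finite set `Q`, `φ : Q → C` is the public
message map, and `B` is the set of pairs `(x,z)` where the conditional mass of
the quantization cell of `x` given `z` is at most `e^(−βn)`. Then there is a
key map `f : Q → S` such that the expected variational distance between the
joint conditional law of `(f(g(X)), φ(g(X)))` given `Z = z` and the product of
the uniform distribution on `S` with the conditional law of `φ(g(X))` given
`Z = z` is at most `√(|S|·|C|·e^(−βn)) + 2·ρ(Bᶜ)`. -/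
theorem stmt_10 {m : ℕ} (ρ : Measure ((Fin m → ℝ) × (Fin m → ℝ)))
    [IsProbabilityMeasure ρ]
    (κ : Kernel (Fin m → ℝ) (Fin m → ℝ)) [IsMarkovKernel κ]
    (hκ : ∀ E : Set ((Fin m → ℝ) × (Fin m → ℝ)), MeasurableSet E →
      ρ E = ∫⁻ z, κ z {x | (x, z) ∈ E} ∂(ρ.map Prod.snd))
    {Q C S : Type*} [Fintype Q] [Fintype C] [Fintype S]
    [MeasurableSpace Q] [DiscreteMeasurableSpace Q]
    [Nonempty Q] [Nonempty C] [Nonempty S]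
    [DecidableEq Q] [DecidableEq C] [DecidableEq S]
    (g : (Fin m → ℝ) → Q) (hg : Measurable g) (φ : Q → C) (β : ℝ) (n : ℕ)
    (B : Set ((Fin m → ℝ) × (Fin m → ℝ)))
    (hB : B = {p | κ p.2 (g ⁻¹' {g p.1}) ≤ ENNReal.ofReal (Real.exp (-β * n))}) :
    ∃ f : Q → S,
      ∫ z, (∑ s : S, ∑ c : C,
          |(κ z {x | f (g x) = s ∧ φ (g x) = c}).toReal -
            (Fintype.card S : ℝ)⁻¹ * (κ z {x | φ (g x) = c}).toReal|)
        ∂(ρ.map Prod.snd)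
      ≤ Real.sqrt (Fintype.card S * Fintype.card C * Real.exp (-β * n))
        + 2 * (ρ Bᶜ).toReal := by
  set ν := ρ.map Prod.snd with hν
  have : IsProbabilityMeasure ν := Measure.isProbabilityMeasure_map measurable_snd.aemeasurable
  set t := Real.exp (-β * n) with ht
  have ht0 : 0 ≤ t := (Real.exp_pos _).le
  set p : (Fin m → ℝ) → Q → ℝ := fun z q => (κ z).real (g ⁻¹' {q}) with hp
  have hp0 : ∀ z q, 0 ≤ p z q := fun z q => measureReal_nonneg
  have hcell : ∀ q, MeasurableSet (g ⁻¹' {q}) := fun q => hg (measurableSet_singleton q)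
  have hpm : ∀ q, Measurable fun z => p z q := fun q =>
    (κ.measurable_coe (hcell q)).ennreal_toReal
  have hpsum : ∀ z, ∑ q, p z q = 1 := by
    intro z
    have h := measureReal_setOf_comp (κ z) hg (fun _ => True)
    simpa using h.symm
  have hdev : ∀ (f : Q → S) z s c,
      (κ z {x | f (g x) = s ∧ φ (g x) = c}).toReal -
        (Fintype.card S : ℝ)⁻¹ * (κ z {x | φ (g x) = c}).toReal = deviation φ f (p z) s c := by
    intro f z s c
    have h1 := measureReal_setOf_comp (κ z) hg (fun q => f q = s ∧ φ q = c)
    have h2 := measureReal_setOf_comp (κ z) hg (fun q => φ q = c)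
    rw [measureReal_def] at h1 h2
    rw [h1, h2, Finset.mul_sum, ← Finset.sum_sub_distrib, deviation]
    refine Finset.sum_congr rfl fun q _ => ?_
    by_cases h : φ q = c <;> by_cases h' : f q = s <;> simp [h, h', centered, hp] <;> ring
  simp only [hdev]
  set F : (Q → S) → (Fin m → ℝ) → ℝ := fun f z => ∑ s, ∑ c, |deviation φ f (p z) s c| with hF
  have hFint : ∀ f, Integrable (F f) ν := by
    intro f
    refine Integrable.of_bound (C := 2) ?_ (ae_of_all _ fun z => ?_)
    · refine Measurable.aestronglyMeasurable ?_
      refine Finset.measurable_sum _ fun s _ => Finset.measurable_sum _ fun c _ => ?_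
      refine Measurable.abs (Finset.measurable_sum _ fun q _ => Measurable.mul_const ?_ _)
      split_ifs
      exacts [hpm q, measurable_const]
    · rw [Real.norm_of_nonneg (by positivity)]
      have h := sum_abs_deviation_le_two_mul φ f (hp0 z)
      rwa [hpsum, mul_one] at h
  set b : (Fin m → ℝ) → ℝ := fun z => ∑ q, if t < p z q then p z q else 0 with hb
  have hb0 : ∀ z, 0 ≤ b z := fun z => Finset.sum_nonneg fun q _ => by
    split_ifs
    exacts [hp0 z q, le_rfl]
  have hbm : Measurable b := Finset.measurable_sum _ fun q _ =>
    Measurable.ite (measurableSet_lt measurable_const (hpm q)) (hpm q) measurable_const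
  have hbint : Integrable b ν := by
    refine Integrable.of_bound (C := 1) hbm.aestronglyMeasurable (ae_of_all _ fun z => ?_)
    rw [Real.norm_of_nonneg (hb0 z), ← hpsum z]
    refine Finset.sum_le_sum fun q _ => ?_
    split_ifs
    exacts [le_rfl, hp0 z q]
  have hBc : Bᶜ = {y | t < p y.2 (g y.1)} := by
    ext y
    rw [hB, Set.mem_compl_iff, Set.mem_ofPred_eq, not_le, Set.mem_ofPred_eq, hp]
    exact ENNReal.ofReal_lt_iff_lt_toReal ht0 (measure_ne_top _ _)
  have hBm : MeasurableSet Bᶜ := by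
    have : Bᶜ = ⋃ q, {y | g y.1 = q} ∩ {y | t < p y.2 q} := by
      rw [hBc]
      ext y
      simp
    rw [this]
    exact MeasurableSet.iUnion fun q => ((hcell q).preimage measurable_fst).inter
      (measurableSet_lt measurable_const ((hpm q).comp measurable_snd))
  have hBint : (ρ Bᶜ).toReal = ∫ z, b z ∂ν := by
    rw [integral_eq_lintegral_of_nonneg_ae (ae_of_all _ hb0) hbm.aestronglyMeasurable,
      hκ _ hBm]
    congr 1
    refine lintegral_congr fun z => ?_
    have h := measureReal_setOf_comp (κ z) hg (fun q => t < p z q)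
    rw [← ENNReal.ofReal_toReal (measure_ne_top (κ z) {x | (x, z) ∈ Bᶜ}), hBc]
    exact congrArg ENNReal.ofReal h
  have htotal : ∑ f : Q → S, ∫ z, F f z ∂ν ≤
      ∑ _f : Q → S, (√(Fintype.card S * Fintype.card C * t) + 2 * (ρ Bᶜ).toReal) := by
    rw [← integral_finsetSum _ fun f _ => hFint f, Finset.sum_const, Finset.card_univ,
      nsmul_eq_mul, hBint]
    calc ∫ z, ∑ f, F f z ∂ν
        ≤ ∫ z, (Fintype.card (Q → S) : ℝ) *
            (√(Fintype.card S * Fintype.card C * t) + 2 * b z) ∂ν := by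
          refine integral_mono (integrable_finsetSum _ fun f _ => hFint f)
            (((integrable_const _).add (hbint.const_mul 2)).const_mul _) fun z => ?_
          exact sum_abs_deviation_le φ ht0 (hp0 z) (hpsum z).le
      _ = _ := by
          rw [integral_const_mul, integral_add (integrable_const _) (hbint.const_mul 2),
            integral_const_mul]
          simp
  obtain ⟨f, -, hf⟩ := Finset.exists_le_of_sum_le Finset.univ_nonempty htotal
  exact ⟨f, hf⟩
end

section
/- Let ρ be a probability measure on ℝ^m × ℝ^m (the joint law of a pair (X,Y)) and let ρ_Y be its second marginal. Let Q and C be finite nonempty sets, let g : ℝ^m → Q be measurable, and let α ∈ ℝ, n ∈ ℕ. For u ∈ Q with ρ({(x,y) : g(x) = u}) > 0, let ν_u be the conditional distribution of Y given g(X) = u, i.e. ν_u(E) = ρ({(x,y) : g(x) = u, y ∈ E}) / ρ({(x,y) : g(x) = u}), and assume ν_u is absolutely continuous with respect to ρ_Y. Define A := {(u,y) ∈ Q × ℝ^m : (dν_u/dρ_Y)(y) ≥ e^{αn}}. Then there exist a function φ : Q → C and a measurable function ψ : C × ℝ^m → Q such that ρ({(x,y) : g(x) ≠ ψ(φ(g(x)),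 y)}) ≤ (|Q|/|C|)·e^{−αn} + ρ({(x,y) : (g(x), y) ∉ A}). -/
open MeasureTheory
open scoped ENNReal

/-- A uniformly random map `φ : Q → C` makes two distinct points collide with probability at most
`1 / |C|`. -/
lemma card_collision_mul_card_le {Q C : Type*} [Fintype Q] [Fintype C] [DecidableEq Q]
    [DecidableEq C] {u v : Q} (huv : u ≠ v) :
    (Finset.univ.filter fun φ : Q → C => φ u = φ v).card * Fintype.card C
      ≤ Fintype.card (Q → C) := by
  rw [← Finset.card_univ (α := C), ← Finset.card_product, ← Finset.card_univ (α := Q → C)]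
  refine Finset.card_le_card_of_injOn (fun p => Function.update p.1 u p.2)
    (fun _ _ => Finset.mem_coe.2 (Finset.mem_univ _)) ?_
  rintro ⟨φ, c⟩ hφ ⟨φ', c'⟩ hφ' h
  simp only [Finset.coe_product, Set.mem_prod, Finset.mem_coe, Finset.mem_filter,
    Finset.mem_univ, true_and, and_true] at hφ hφ'
  have happ : ∀ w, Function.update φ u c w = Function.update φ' u c' w := fun w => congrFun h w
  have hc : c = c' := by simpa using happ u
  have hne : ∀ w, w ≠ u → φ w = φ' w := fun w hw => by simpa [hw] using happ w
  refine Prod.ext (funext fun w => ?_) hc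
  by_cases hw : w = u
  · rw [hw]
    exact hφ.trans ((hne v huv.symm).trans hφ'.symm)
  · exact hne w hw

/-- Some map `φ : Q → C` has total collision weight at most the average `(∑ w) / |C|`. -/
lemma exists_sum_collision_le {Q C : Type*} [Fintype Q] [Fintype C] [Nonempty C]
    [DecidableEq Q] [DecidableEq C] (w : Q → Q → ℝ≥0∞) :
    ∃ φ : Q → C, ∑ u, ∑ v, (if u ≠ v ∧ φ u = φ v then w u v else 0)
      ≤ (∑ u, ∑ v, w u v) / Fintype.card C := by
  have hC0 : (Fintype.card C : ℝ≥0∞) ≠ 0 := by simp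
  have hCt : (Fintype.card C : ℝ≥0∞) ≠ ∞ := ENNReal.natCast_ne_top _
  have hpair : ∀ u v, ∑ φ : Q → C, (if u ≠ v ∧ φ u = φ v then w u v else 0)
      ≤ Fintype.card (Q → C) * (w u v / Fintype.card C) := by
    intro u v
    by_cases huv : u = v
    · simp [huv]
    have hcard : ((Finset.univ.filter fun φ : Q → C => φ u = φ v).card : ℝ≥0∞)
        ≤ Fintype.card (Q → C) / Fintype.card C := by
      rw [ENNReal.le_div_iff_mul_le (Or.inl hC0) (Or.inl hCt)]
      exact_mod_cast card_collision_mul_card_le (C := C) huv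
    simp only [ne_eq, huv, not_false_eq_true, true_and]
    rw [← Finset.sum_filter, Finset.sum_const, nsmul_eq_mul]
    calc _ ≤ (Fintype.card (Q → C) / Fintype.card C : ℝ≥0∞) * w u v := by gcongr
      _ = _ := by simp only [div_eq_mul_inv]; ring
  obtain ⟨φ, -, hmin⟩ := Finset.exists_min_image (Finset.univ : Finset (Q → C))
    (fun φ => ∑ u, ∑ v, (if u ≠ v ∧ φ u = φ v then w u v else 0)) Finset.univ_nonempty
  refine ⟨φ, ?_⟩
  have hN0 : (Fintype.card (Q → C) : ℝ≥0∞) ≠ 0 := by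
    exact_mod_cast (Fintype.card_pos (α := Q → C)).ne'
  rw [← ENNReal.mul_le_mul_iff_right hN0 (ENNReal.natCast_ne_top _), ← nsmul_eq_mul,
    ← Finset.card_univ]
  refine (Finset.card_nsmul_le_sum _ _ _ hmin).trans ?_
  rw [Finset.sum_comm, Finset.card_univ]
  simp only [div_eq_mul_inv, Finset.sum_mul, Finset.mul_sum]
  refine Finset.sum_le_sum fun u _ => ?_
  rw [Finset.sum_comm]
  exact Finset.sum_le_sum fun v _ => hpair u v

/-- Given finitely many measurable sets `B u`, there is a measurable decoder which, from the bin `c`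
and the observation `y`, returns some `u` in the bin with `y ∈ B u` whenever there is one. -/
lemma exists_measurable_decoder {Q C Y : Type*} [Finite Q] [Nonempty Q] [MeasurableSpace Q]
    [MeasurableSpace Y] {B : Q → Set Y} (hB : ∀ u, MeasurableSet (B u)) (φ : Q → C) :
    ∃ ψ : C → Y → Q, (∀ c, Measurable (ψ c)) ∧
      ∀ c y, (∃ u, φ u = c ∧ y ∈ B u) → φ (ψ c y) = c ∧ y ∈ B (ψ c y) := by
  refine ⟨fun c y => Classical.epsilon fun u => φ u = c ∧ y ∈ B u, fun c => ?_,
    fun c y h => Classical.epsilon_spec h⟩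
  have hmem : Measurable fun y => fun u => y ∈ B u :=
    measurable_pi_iff.2 fun u => measurable_mem.2 (hB u)
  exact (measurable_of_countable
    fun s : Q → Prop => Classical.epsilon fun u => φ u = c ∧ s u).comp hmem

/-- Random binning with arbitrary acceptance sets `B u` of small marginal probability. -/
lemma exists_binning {X Y Q C : Type*} [MeasurableSpace X] [MeasurableSpace Y]
    (ρ : Measure (X × Y)) [Fintype Q] [Fintype C] [Nonempty Q] [Nonempty C]
    [MeasurableSpace Q] [DiscreteMeasurableSpace Q] {g : X → Q} (hg : Measurable g)
    {B : Q → Set Y} (hB : ∀ u, MeasurableSet (B u)) {b : ℝ≥0∞}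
    (hb : ∀ u, ρ.map Prod.snd (B u) ≤ b) :
    ∃ (φ : Q → C) (ψ : C → Y → Q), (∀ c, Measurable (ψ c)) ∧
      ρ {p | g p.1 ≠ ψ (φ (g p.1)) p.2}
        ≤ Fintype.card Q * b / Fintype.card C + ρ {p | p.2 ∉ B (g p.1)} := by
  classical
  obtain ⟨φ, hφ⟩ := exists_sum_collision_le (Q := Q) (C := C)
    fun u v => ρ {p | g p.1 = u ∧ p.2 ∈ B v}
  obtain ⟨ψ, hψm, hψ⟩ := exists_measurable_decoder hB φ
  have hfib : ∀ u, MeasurableSet {p : X × Y | g p.1 = u} := fun u =>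
    (hg.comp measurable_fst) (measurableSet_singleton u)
  have hmarg : ∀ v, ∑ u, ρ {p | g p.1 = u ∧ p.2 ∈ B v} = ρ.map Prod.snd (B v) := by
    intro v
    rw [Measure.map_apply measurable_snd (hB v),
      ← measure_biUnion_finset (s := Finset.univ)
        (f := fun u => {p : X × Y | g p.1 = u ∧ p.2 ∈ B v})]
    · congr 1
      ext p
      simp
    · intro u _ u' _ huu'
      exact Set.disjoint_left.2 fun p hp hp' => huu' (hp.1.symm.trans hp'.1)
    · exact fun u _ => (hfib u).inter (measurable_snd (hB v))
  refine ⟨φ, ψ, hψm, ?_⟩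
  have hsub : {p : X × Y | g p.1 ≠ ψ (φ (g p.1)) p.2}
      ⊆ (⋃ u, ⋃ v, {p | (u ≠ v ∧ φ u = φ v) ∧ g p.1 = u ∧ p.2 ∈ B v})
        ∪ {p | p.2 ∉ B (g p.1)} := by
    intro p hp
    by_cases hpB : p.2 ∈ B (g p.1)
    · obtain ⟨hbin, hacc⟩ := hψ (φ (g p.1)) p.2 ⟨g p.1, rfl, hpB⟩
      exact Or.inl (Set.mem_iUnion₂.2 ⟨g p.1, _, ⟨hp, hbin.symm⟩, rfl, hacc⟩)
    · exact Or.inr hpB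
  refine (measure_mono hsub).trans ((measure_union_le _ _).trans ?_)
  gcongr
  calc ρ (⋃ u, ⋃ v, {p | (u ≠ v ∧ φ u = φ v) ∧ g p.1 = u ∧ p.2 ∈ B v})
      ≤ ∑ u, ∑ v, ρ {p | (u ≠ v ∧ φ u = φ v) ∧ g p.1 = u ∧ p.2 ∈ B v} :=
        (measure_iUnion_fintype_le _ _).trans
          (Finset.sum_le_sum fun u _ => measure_iUnion_fintype_le _ _)
    _ = ∑ u, ∑ v, (if u ≠ v ∧ φ u = φ v then ρ {p | g p.1 = u ∧ p.2 ∈ B v} else 0) := by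
        refine Finset.sum_congr rfl fun u _ => Finset.sum_congr rfl fun v _ => ?_
        split_ifs with h <;> simp [h]
    _ ≤ (∑ u, ∑ v, ρ {p | g p.1 = u ∧ p.2 ∈ B v}) / Fintype.card C := hφ
    _ ≤ Fintype.card Q * b / Fintype.card C := by
        gcongr
        rw [Finset.sum_comm, ← nsmul_eq_mul, ← Finset.card_univ]
        exact Finset.sum_le_card_nsmul _ _ _ fun v _ => (hmarg v).trans_le (hb v)

/-- Markov's inequality for a Radon-Nikodym derivative. -/
lemma measure_le_rnDeriv_le {Y : Type*} [MeasurableSpace Y] (μ ν : Measure Y)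
    {t : ℝ≥0∞} (ht0 : t ≠ 0) (htt : t ≠ ∞) :
    μ {y | t ≤ ν.rnDeriv μ y} ≤ ν Set.univ / t :=
  (meas_ge_le_lintegral_div (Measure.measurable_rnDeriv ν μ).aemeasurable ht0 htt).trans
    (ENNReal.div_le_div_right Measure.lintegral_rnDeriv_le _)

/-- Bin-coding lemma (Lemma 3). `ρ` is the joint law of `(X,Y)`
on `ℝ^m × ℝ^m` with second marginal `ρ_Y = ρ.map Prod.snd`, `g` quantizes
Alice's source into the finite set `Q`, and for each `u` with
`ρ(g(X) = u) > 0`, `ν u` is the conditional law of `Y` given `g(X) = u`,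
assumed absolutely continuous w.r.t. `ρ_Y`. With
`A = {(u,y) : (dν_u/dρ_Y)(y) ≥ e^(αn)}`, there exist a bin map `φ : Q → C` and
a measurable decoder `ψ` such that
`ρ(g(X) ≠ ψ(φ(g(X)), Y)) ≤ (|Q|/|C|)·e^(−αn) + ρ((g(X),Y) ∉ A)`. -/
theorem stmt_11 {m : ℕ} (ρ : Measure ((Fin m → ℝ) × (Fin m → ℝ)))
    [IsProbabilityMeasure ρ]
    {Q C : Type*} [Fintype Q] [Fintype C] [Nonempty Q] [Nonempty C]
    [MeasurableSpace Q] [DiscreteMeasurableSpace Q]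
    (g : (Fin m → ℝ) → Q) (hg : Measurable g) (α : ℝ) (n : ℕ)
    (ν : Q → Measure (Fin m → ℝ))
    (hν : ∀ u : Q, ρ {p | g p.1 = u} ≠ 0 →
      ν u = (ρ {p | g p.1 = u})⁻¹ •
        ((ρ.restrict {p | g p.1 = u}).map Prod.snd))
    (hac : ∀ u : Q, ρ {p | g p.1 = u} ≠ 0 → ν u ≪ ρ.map Prod.snd)
    (A : Set (Q × (Fin m → ℝ)))
    (hA : A = {q | ENNReal.ofReal (Real.exp (α * n)) ≤
      (ν q.1).rnDeriv (ρ.map Prod.snd) q.2}) :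
    ∃ (φ : Q → C) (ψ : C → (Fin m → ℝ) → Q), (∀ c, Measurable (ψ c)) ∧
      ρ {p | g p.1 ≠ ψ (φ (g p.1)) p.2}
        ≤ ENNReal.ofReal
            ((Fintype.card Q : ℝ) / (Fintype.card C : ℝ) * Real.exp (-α * n))
          + ρ {p | (g p.1, p.2) ∉ A} := by
  classical
  have ht0 : ENNReal.ofReal (Real.exp (α * n)) ≠ 0 := by simp [Real.exp_pos]
  let B : Q → Set (Fin m → ℝ) := fun u =>
    if ρ {p | g p.1 = u} = 0 then ∅
    else {y | ENNReal.ofReal (Real.exp (α * n)) ≤ (ν u).rnDeriv (ρ.map Prod.snd) y}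
  have hB : ∀ u, MeasurableSet (B u) := by
    intro u
    simp only [B]
    split_ifs
    · exact MeasurableSet.empty
    · exact measurableSet_le measurable_const (Measure.measurable_rnDeriv _ _)
  have hb : ∀ u, ρ.map Prod.snd (B u) ≤ ENNReal.ofReal (Real.exp (-α * n)) := by
    intro u
    simp only [B]
    split_ifs with hu
    · simp
    · refine (measure_le_rnDeriv_le _ _ ht0 ENNReal.ofReal_ne_top).trans_eq ?_
      have hmass : ν u Set.univ = 1 := by
        rw [hν u hu, Measure.smul_apply, Measure.map_apply measurable_snd MeasurableSet.univ]
        simp [ENNReal.inv_mul_cancel hu (measure_ne_top ρ _)]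
      rw [hmass, one_div, ← ENNReal.ofReal_inv_of_pos (Real.exp_pos _), ← Real.exp_neg, neg_mul]
  obtain ⟨φ, ψ, hψ, hle⟩ := exists_binning (C := C) ρ hg hB hb
  refine ⟨φ, ψ, hψ, hle.trans (add_le_add (le_of_eq ?_) ?_)⟩
  · have hC : (0 : ℝ) < Fintype.card C := by exact_mod_cast Fintype.card_pos
    rw [div_mul_eq_mul_div, ENNReal.ofReal_div_of_pos hC,
      ENNReal.ofReal_mul (Nat.cast_nonneg _), ENNReal.ofReal_natCast, ENNReal.ofReal_natCast]
  · have hnull : ρ (⋃ u ∈ {u | ρ {p | g p.1 = u} = 0}, {p | g p.1 = u}) = 0 :=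
      (measure_biUnion_null_iff (Set.to_countable _)).2 fun _ hu => hu
    refine (measure_mono fun p hp => ?_).trans
      ((measure_union_le {p | (g p.1, p.2) ∉ A} _).trans_eq (by rw [hnull, add_zero]))
    by_cases hu : ρ {q | g q.1 = g p.1} = 0
    · exact Or.inr (Set.mem_iUnion₂.2 ⟨g p.1, hu, rfl⟩)
    · refine Or.inl ?_
      simpa [B, hu, hA] using hp
end
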